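/- Let 1 ≤ p ≤ 2, let a₁ ≥ a₂ ≥ … > 0 be a nonincreasing sequence with a_t → 0, and let Γ = {θ ∈ ℓ²(ℕ) : Σ_{t≥1} |θ_t|^p / a_t^p ≤ 1}. Let D_c(Γ, ε) = min{ D ≥ 1 : a_D ≤ ε } and, with δ = 1/32, define d_u(Γ, n, ε) = max{ d : a_d^p · n^{(p−2)/2} ≥ (ε²/9)/(576·log(4·D_c(Γ, ε/3)/δ)) }. If the positive integers (m, n) satisfy m ≥ 32/ε², n ≥ 32·√(d_u(Γ, n, ε))/ε², and m·n ≥ 512·d_u(Γ, n, ε)/ε⁴, then (m, n) is LFHT-feasible for Γ at separation ε. -/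

import Mathlib

open MeasureTheory ProbabilityTheory Real
open scoped RealInnerProductSpace ENNReal

/-- The real Hilbert space `ℓ²(ℕ)` of square-summable sequences. -/
noncomputable abbrev SeqL2 : Type := lp (fun _ : ℕ => ℝ) 2

/-- The joint law of `n` i.i.d. samples from `ν`. -/
noncomputable def iidSamples {E : Type*} [MeasurableSpace E] (n : ℕ) (ν : Measure E) :
    Measure (Fin n → E) :=
  Measure.pi (fun _ => ν)

/-- `ν` is the Gaussian sequence measure `N(θ, I_∞) = ⊗_{i ≥ 0} N(θ_i, 1)` on `ℝ^ℕ`: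
a probability measure whose finite-dimensional marginals are the corresponding finite
product Gaussians.  (Such a measure exists and is unique.) -/
def IsGaussianSeq (θ : ℕ → ℝ) (ν : Measure (ℕ → ℝ)) : Prop :=
  IsProbabilityMeasure ν ∧
    IsProjectiveLimit ν (fun J : Finset ℕ => Measure.pi (fun j : J => gaussianReal (θ j) 1))

/-- Goodness-of-fit sample complexity in the Gaussian sequence model, where
`G θ = N(θ, I_∞)`: the smallest `n` admitting a measurable test with both errors `≤ 1/4`. -/
noncomputable def nGofSeq (G : (ℕ → ℝ) → Measure (ℕ → ℝ)) (Γ : Set SeqL2) (ε : ℝ) : ℕ :=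
  sInf {n : ℕ | ∃ ψ : (Fin n → (ℕ → ℝ)) → Bool, Measurable ψ ∧
    (iidSamples n (G 0)) {x | ψ x = true} ≤ 1/4 ∧
    ∀ θ ∈ Γ, ε ≤ ‖θ‖ → (iidSamples n (G ⇑θ)) {x | ψ x = false} ≤ 1/4}

/-- Estimation sample complexity in the Gaussian sequence model, where `G θ = N(θ, I_∞)`:
the smallest `n` admitting a measurable estimator with worst-case expected squared
`ℓ²`-error at most `ε²` over `Γ`. -/
noncomputable def nEstSeq (G : (ℕ → ℝ) → Measure (ℕ → ℝ)) (Γ : Set SeqL2) (ε : ℝ) : ℕ :=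
  sInf {n : ℕ | ∃ est : (Fin n → (ℕ → ℝ)) → (ℕ → ℝ), Measurable est ∧
    ∀ θ ∈ Γ,
      (∫⁻ x, (∑' i, ENNReal.ofReal ((est x i - θ i) ^ 2)) ∂(iidSamples n (G ⇑θ)))
        ≤ ENNReal.ofReal (ε ^ 2)}

/-- `(m, n)` is LFHT-feasible for `Γ ⊆ ℓ²(ℕ)` at separation `ε` in the Gaussian sequence
model, where `G θ = N(θ, I_∞)`. -/
def LFHTFeasibleSeq (G : (ℕ → ℝ) → Measure (ℕ → ℝ)) (Γ : Set SeqL2) (ε : ℝ)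
    (m n : ℕ) : Prop :=
  ∃ ψ : (Fin n → (ℕ → ℝ)) × (Fin n → (ℕ → ℝ)) × (Fin m → (ℕ → ℝ)) → Bool,
    Measurable ψ ∧
    ∀ θ1 ∈ Γ, ∀ θ2 ∈ Γ, ε ≤ ‖θ1 - θ2‖ →
      (((iidSamples n (G ⇑θ1)).prod
          ((iidSamples n (G ⇑θ2)).prod (iidSamples m (G ⇑θ1))))
            {x | ψ x = true} ≤ 1/4 ∧
        ((iidSamples n (G ⇑θ1)).prod
          ((iidSamples n (G ⇑θ2)).prod (iidSamples m (G ⇑θ2))))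
            {x | ψ x = false} ≤ 1/4)

/-- One-sided Chebyshev inequality: the square-integrable `T` is rarely nonpositive if its
mean is positive and its variance is at most `c` times the squared mean. -/
lemma measureReal_nonpos_le_of_variance_le {Ω : Type*} [MeasurableSpace Ω] {P : Measure Ω}
    [IsProbabilityMeasure P] {T : Ω → ℝ} (hT : MemLp T 2 P) (hpos : 0 < ∫ ω, T ω ∂P) {c : ℝ}
    (hc : 0 ≤ c) (hvar : Var[T; P] ≤ c * (∫ ω, T ω ∂P) ^ 2) :
    P.real {ω | T ω ≤ 0} ≤ c / (1 + c) := by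
  set μ := ∫ ω, T ω ∂P with hμ
  set b := μ * (1 + c) with hb
  have hbpos : 0 < b := by positivity
  have hTb : MemLp (fun ω ↦ T ω - b) 2 P := hT.sub (memLp_const b)
  have hmean : ∫ ω, (T ω - b) ∂P = μ - b := by
    rw [integral_sub (hT.integrable (by norm_num)) (integrable_const b)]
    simp [hμ]
  have hsq : ∫ ω, (T ω - b) ^ 2 ∂P = Var[T; P] + (μ - b) ^ 2 := by
    have h := variance_eq_sub hTb
    rw [variance_sub_const hT.aestronglyMeasurable, hmean] at h
    simp only [Pi.pow_apply] at h
    linarith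
  have hmarkov := mul_meas_ge_le_integral_of_nonneg (μ := P) (f := fun ω ↦ (T ω - b) ^ 2)
    (Filter.Eventually.of_forall fun ω ↦ sq_nonneg _) hTb.integrable_sq (b ^ 2)
  have hsub : P.real {ω | T ω ≤ 0} ≤ P.real {ω | b ^ 2 ≤ (T ω - b) ^ 2} := by
    refine measureReal_mono fun ω (hω : T ω ≤ 0) ↦ ?_
    simp only [Set.mem_ofPred_eq]
    nlinarith
  have hbound : b ^ 2 * P.real {ω | T ω ≤ 0} ≤ c * (1 + c) * μ ^ 2 := by
    calc b ^ 2 * P.real {ω | T ω ≤ 0} ≤ b ^ 2 * P.real {ω | b ^ 2 ≤ (T ω - b) ^ 2} := by gcongr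
      _ ≤ Var[T; P] + (μ - b) ^ 2 := hmarkov.trans_eq hsq
      _ ≤ c * μ ^ 2 + (μ - b) ^ 2 := by gcongr
      _ = c * (1 + c) * μ ^ 2 := by rw [hb]; ring
  rw [le_div_iff₀ (by positivity)]
  have hfac : b ^ 2 * P.real {ω | T ω ≤ 0} = ((1 + c) * μ ^ 2) * (P.real {ω | T ω ≤ 0} * (1 + c)) := by
    rw [hb]; ring
  have : ((1 + c) * μ ^ 2) * (P.real {ω | T ω ≤ 0} * (1 + c)) ≤ ((1 + c) * μ ^ 2) * c := by
    rw [← hfac]; linarith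
  exact le_of_mul_le_mul_left this (by positivity)

lemma memLp_two_mul_of_indepFun {Ω : Type*} [MeasurableSpace Ω] {P : Measure Ω} {F W : Ω → ℝ}
    (hF : MemLp F 2 P) (hW : MemLp W 2 P) (h : IndepFun F W P) :
    MemLp (fun ω ↦ F ω * W ω) 2 P := by
  refine (memLp_two_iff_integrable_sq (hF.1.mul hW.1)).2 ?_
  have hsq : Measurable fun x : ℝ ↦ x ^ 2 := by fun_prop
  have := (h.comp hsq hsq).integrable_mul hF.integrable_sq hW.integrable_sq
  refine this.congr (Filter.Eventually.of_forall fun ω ↦ ?_)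
  simp [mul_pow]

lemma variance_mul_of_indepFun {Ω : Type*} [MeasurableSpace Ω] {P : Measure Ω}
    [IsProbabilityMeasure P] {F W : Ω → ℝ}
    (hF : MemLp F 2 P) (hW : MemLp W 2 P) (h : IndepFun F W P) :
    Var[fun ω ↦ F ω * W ω; P] =
      Var[W; P] * ∫ ω, F ω ^ 2 ∂P + Var[F; P] * (∫ ω, W ω ∂P) ^ 2 := by
  have hsq : Measurable fun x : ℝ ↦ x ^ 2 := by fun_prop
  have h2 := (h.comp hsq hsq).integral_fun_mul_eq_mul_integral hF.integrable_sq.1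
    hW.integrable_sq.1
  have h1 := h.integral_fun_mul_eq_mul_integral hF.1 hW.1
  rw [variance_eq_sub (memLp_two_mul_of_indepFun hF hW h), variance_eq_sub hF, variance_eq_sub hW]
  simp only [Pi.pow_apply, mul_pow, Function.comp_apply] at h2 ⊢
  rw [h2, h1]
  ring

/-- Two-sided Gaussian tail bound. -/
lemma measureReal_abs_sub_gt_le_of_hasLaw_gaussianReal {Ω : Type*} [MeasurableSpace Ω]
    {P : Measure Ω} [IsProbabilityMeasure P] {X : Ω → ℝ} {μ : ℝ} {v : NNReal}
    (hX : HasLaw X (gaussianReal μ v) P) {r : ℝ} (hr : 0 ≤ r) :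
    P.real {ω | r < |X ω - μ|} ≤ 2 * Real.exp (-r ^ 2 / (2 * v)) := by
  have hlaw : HasLaw (fun ω ↦ X ω - μ) (gaussianReal 0 v) P := by
    simpa using gaussianReal_sub_const hX μ
  have hsub : HasSubgaussianMGF (fun ω ↦ X ω - μ) v P := by
    refine ⟨fun t ↦ ?_, fun t ↦ ?_⟩
    · have := integrable_exp_mul_gaussianReal (μ := 0) (v := v) t
      rw [← hlaw.map_eq] at this
      exact this.comp_aemeasurable hlaw.aemeasurable
    · rw [mgf_gaussianReal hlaw.map_eq]
      simp
  have hup := hsub.measure_ge_le hr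
  have hlow := hsub.neg.measure_ge_le hr
  calc P.real {ω | r < |X ω - μ|}
      ≤ P.real ({ω | r ≤ X ω - μ} ∪ {ω | r ≤ (-fun ω ↦ X ω - μ) ω}) := by
        refine measureReal_mono fun ω (hω : r < |X ω - μ|) ↦ ?_
        rcases lt_abs.1 hω with h | h
        · exact Or.inl h.le
        · exact Or.inr h.le
    _ ≤ _ := (measureReal_union_le _ _).trans (by linarith)

/-- Hard thresholding at level `l`. -/
noncomputable def hardThreshold (l u : ℝ) : ℝ := if l ≤ |u| then u else 0

lemma measurable_hardThreshold (l : ℝ) : Measurable (hardThreshold l) :=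
  Measurable.ite (measurableSet_le measurable_const (by fun_prop)) measurable_id measurable_const

/-- Hard thresholding at level `29 * r` of the projection of `u` to `[δ - r, δ + r]`. -/
noncomputable def clippedThreshold (r δ u : ℝ) : ℝ :=
  hardThreshold (29 * r) (max (δ - r) (min u (δ + r)))

lemma measurable_clippedThreshold (r δ : ℝ) : Measurable (clippedThreshold r δ) :=
  (measurable_hardThreshold _).comp (by fun_prop)

lemma clippedThreshold_eq_hardThreshold {r δ u : ℝ} (h : |u - δ| ≤ r) :
    clippedThreshold r δ u = hardThreshold (29 * r) u := by
  rw [abs_le] at h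
  rw [clippedThreshold, min_eq_left (by linarith), max_eq_right (by linarith)]

lemma abs_clip_sub_le {r : ℝ} (hr : 0 < r) (δ u : ℝ) :
    |max (δ - r) (min u (δ + r)) - δ| ≤ r := by
  rw [abs_le]
  constructor
  · linarith [le_max_left (δ - r) (min u (δ + r))]
  · have : max (δ - r) (min u (δ + r)) ≤ δ + r := max_le (by linarith) (min_le_right _ _)
    linarith

lemma clippedThreshold_sq_le {r : ℝ} (hr : 0 < r) (δ u : ℝ) :
    clippedThreshold r δ u ^ 2 ≤ 29 / 28 * (clippedThreshold r δ u * δ) := by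
  have h := abs_le.1 (abs_clip_sub_le hr δ u)
  unfold clippedThreshold hardThreshold
  set x := max (δ - r) (min u (δ + r))
  split_ifs with hx
  · rcases le_abs.1 hx with hx | hx <;> nlinarith
  · simp

lemma clippedThreshold_mul_nonneg {r : ℝ} (hr : 0 < r) (δ u : ℝ) :
    0 ≤ clippedThreshold r δ u * δ := by
  nlinarith [clippedThreshold_sq_le hr δ u, sq_nonneg (clippedThreshold r δ u)]

lemma le_clippedThreshold_mul {r δ : ℝ} (hr : 0 < r) (hδ : 30 * r ≤ |δ|) (u : ℝ) :
    29 / 30 * δ ^ 2 ≤ clippedThreshold r δ u * δ := by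
  have h := abs_le.1 (abs_clip_sub_le hr δ u)
  unfold clippedThreshold hardThreshold
  set x := max (δ - r) (min u (δ + r))
  have hx : 29 * r ≤ |x| := by
    rcases le_abs.1 hδ with hδ | hδ
    · exact le_abs.2 (Or.inl (by linarith))
    · exact le_abs.2 (Or.inr (by linarith))
  rw [if_pos hx]
  rcases le_abs.1 hδ with hδ | hδ <;> nlinarith

lemma exists_clippedThreshold_mem_Icc {r : ℝ} (hr : 0 < r) (δ : ℝ) :
    ∃ c, ∀ u, clippedThreshold r δ u ∈ Set.Icc (c - 31 * r) (c + 31 * r) := by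
  by_cases hδ : 30 * r ≤ |δ|
  · refine ⟨δ, fun u ↦ ?_⟩
    have h := abs_le.1 (abs_clip_sub_le hr δ u)
    unfold clippedThreshold hardThreshold
    set x := max (δ - r) (min u (δ + r))
    have hx : 29 * r ≤ |x| := by
      rcases le_abs.1 hδ with hδ | hδ
      · exact le_abs.2 (Or.inl (by linarith))
      · exact le_abs.2 (Or.inr (by linarith))
    rw [if_pos hx]
    constructor <;> linarith
  · refine ⟨0, fun u ↦ ?_⟩
    have h := abs_le.1 (abs_clip_sub_le hr δ u)
    have hδ' := abs_lt.1 (not_le.1 hδ)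
    unfold clippedThreshold hardThreshold
    set x := max (δ - r) (min u (δ + r))
    split_ifs
    · constructor <;> linarith
    · constructor <;> linarith

section ThresholdedStatistic

variable {Ω : Type*} [MeasurableSpace Ω] {P : Measure Ω} [IsProbabilityMeasure P]

lemma memLp_two_clippedThreshold {U : Ω → ℝ} (hU : Measurable U) {r : ℝ} (hr : 0 < r) (δ : ℝ) :
    MemLp (fun ω ↦ clippedThreshold r δ (U ω)) 2 P := by
  obtain ⟨c, hc⟩ := exists_clippedThreshold_mem_Icc hr δ
  exact memLp_of_bounded (Filter.Eventually.of_forall fun ω ↦ hc (U ω))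
    ((measurable_clippedThreshold r δ).comp hU).aestronglyMeasurable 2

/-- The statistic `∑ F (U t) * W t`, for independent pairs of independent variables. -/
lemma measureReal_sum_mul_nonpos_le {K : Finset ℕ} {F : ℕ → ℝ → ℝ} {U W : ℕ → Ω → ℝ}
    {Δ : ℕ → ℝ} {σ2 c : ℝ} (hF : ∀ t, Measurable (F t))
    (hFU : ∀ t ∈ K, MemLp (fun ω ↦ F t (U t ω)) 2 P)
    (hW : ∀ t, MemLp (W t) 2 P) (hWmean : ∀ t, ∫ ω, W t ω ∂P = Δ t / 2)
    (hWvar : ∀ t, Var[W t; P] = σ2) (hUW : ∀ t, IndepFun (U t) (W t) P)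
    (hpair : ∀ s t, s ≠ t → IndepFun (fun ω ↦ (U s ω, W s ω)) (fun ω ↦ (U t ω, W t ω)) P)
    (hc : 0 ≤ c) (hpos : 0 < ∑ t ∈ K, (∫ ω, F t (U t ω) ∂P) * Δ t)
    (hvar : ∑ t ∈ K, (σ2 * ∫ ω, F t (U t ω) ^ 2 ∂P + Var[fun ω ↦ F t (U t ω); P] * (Δ t / 2) ^ 2)
      ≤ c * ((∑ t ∈ K, (∫ ω, F t (U t ω) ∂P) * Δ t) / 2) ^ 2) :
    P.real {ω | ∑ t ∈ K, F t (U t ω) * W t ω ≤ 0} ≤ c / (1 + c) := by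
  have hind : ∀ t, IndepFun (fun ω ↦ F t (U t ω)) (W t) P := fun t ↦
    (hUW t).comp (hF t) measurable_id
  have hmem : ∀ t ∈ K, MemLp (fun ω ↦ F t (U t ω) * W t ω) 2 P := fun t ht ↦
    memLp_two_mul_of_indepFun (hFU t ht) (hW t) (hind t)
  have hmean : ∫ ω, ∑ t ∈ K, F t (U t ω) * W t ω ∂P =
      (∑ t ∈ K, (∫ ω, F t (U t ω) ∂P) * Δ t) / 2 := by
    rw [integral_finsetSum _ fun t ht ↦ (hmem t ht).integrable (by norm_num), Finset.sum_div]
    refine Finset.sum_congr rfl fun t ht ↦ ?_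
    rw [(hind t).integral_fun_mul_eq_mul_integral (hFU t ht).1 (hW t).1, hWmean]
    ring
  have hV : Var[fun ω ↦ ∑ t ∈ K, F t (U t ω) * W t ω; P] =
      ∑ t ∈ K, (σ2 * ∫ ω, F t (U t ω) ^ 2 ∂P
        + Var[fun ω ↦ F t (U t ω); P] * (Δ t / 2) ^ 2) := by
    have heq : (fun ω ↦ ∑ t ∈ K, F t (U t ω) * W t ω) = ∑ t ∈ K, fun ω ↦ F t (U t ω) * W t ω := by
      ext ω; simp
    rw [heq, IndepFun.variance_sum hmem]
    · refine Finset.sum_congr rfl fun t ht ↦ ?_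
      rw [variance_mul_of_indepFun (hFU t ht) (hW t) (hind t), hWvar, hWmean]
    · intro s _ t _ hst
      have hm : ∀ t, Measurable fun q : ℝ × ℝ ↦ F t q.1 * q.2 := fun t ↦
        ((hF t).comp measurable_fst).mul measurable_snd
      exact (hpair s t hst).comp (hm s) (hm t)
  refine measureReal_nonpos_le_of_variance_le (memLp_finsetSum K hmem) ?_ hc ?_
  · rw [hmean]; linarith
  · rw [hmean, hV]; exact hvar

/-- Error bound for the statistic that uses all coordinates in `H` and only those coordinates of
`M` which pass a threshold. -/
lemma measureReal_thresholded_sum_nonpos_le {H M : Finset ℕ} (hHM : Disjoint H M)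
    {U W : ℕ → Ω → ℝ} {Δ : ℕ → ℝ} {σ2 r : ℝ} {τ2 : NNReal} (hr : 0 < r)
    (hUm : ∀ t, Measurable (U t)) (hU : ∀ t, HasLaw (U t) (gaussianReal (Δ t) τ2) P)
    (hW : ∀ t, MemLp (W t) 2 P) (hWmean : ∀ t, ∫ ω, W t ω ∂P = Δ t / 2)
    (hWvar : ∀ t, Var[W t; P] = σ2) (hUW : ∀ t, IndepFun (U t) (W t) P)
    (hpair : ∀ s t, s ≠ t → IndepFun (fun ω ↦ (U s ω, W s ω)) (fun ω ↦ (U t ω, W t ω)) P)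
    (hσ : 0 ≤ σ2)
    (hpos : 0 < ∑ t ∈ H, Δ t ^ 2 + 29 / 30 * ∑ t ∈ M with 30 * r ≤ |Δ t|, Δ t ^ 2)
    (hnum : ∀ S, ∑ t ∈ H, Δ t ^ 2 + 29 / 30 * ∑ t ∈ M with 30 * r ≤ |Δ t|, Δ t ^ 2 ≤ S →
      σ2 * (29 / 28 * S + H.card * τ2) + τ2 / 4 * ∑ t ∈ H, Δ t ^ 2
        + 961 * r ^ 2 / 4 * ∑ t ∈ M, Δ t ^ 2 ≤ 33 / 100 * (S / 2) ^ 2) :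
    P.real {ω | ∑ t ∈ H, U t ω * W t ω + ∑ t ∈ M, hardThreshold (29 * r) (U t ω) * W t ω ≤ 0}
      ≤ 33 / 133 + M.card * (2 * Real.exp (-r ^ 2 / (2 * τ2))) := by
  classical
  set F : ℕ → ℝ → ℝ := fun t u ↦ if t ∈ H then u else clippedThreshold r (Δ t) u with hFdef
  have hFH : ∀ t ∈ H, F t = id := fun t ht ↦ by ext u; simp [hFdef, ht]
  have hFM : ∀ t ∈ M, F t = clippedThreshold r (Δ t) := fun t ht ↦ by
    ext u; simp [hFdef, Finset.disjoint_right.1 hHM ht]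
  have hFmeas : ∀ t, Measurable (F t) := fun t ↦ by
    by_cases ht : t ∈ H
    · rw [hFH t ht]; exact measurable_id
    · have : F t = clippedThreshold r (Δ t) := by ext u; simp [hFdef, ht]
      rw [this]; exact measurable_clippedThreshold _ _
  have hUL : ∀ t, MemLp (U t) 2 P := fun t ↦ (hU t).hasGaussianLaw.memLp_two
  have hUmean : ∀ t, ∫ ω, U t ω ∂P = Δ t := fun t ↦ by
    rw [(hU t).integral_eq, integral_id_gaussianReal]
  have hUvar : ∀ t, Var[U t; P] = τ2 := fun t ↦ by
    rw [(hU t).variance_eq, variance_id_gaussianReal]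
  have hUsq : ∀ t, ∫ ω, U t ω ^ 2 ∂P = Δ t ^ 2 + τ2 := fun t ↦ by
    have := variance_eq_sub (hUL t)
    rw [hUvar, hUmean] at this
    simp only [Pi.pow_apply] at this
    linarith
  have hCL : ∀ t, MemLp (fun ω ↦ clippedThreshold r (Δ t) (U t ω)) 2 P := fun t ↦
    memLp_two_clippedThreshold (hUm t) hr _
  have hCint : ∀ t, Integrable (fun ω ↦ clippedThreshold r (Δ t) (U t ω)) P := fun t ↦
    (hCL t).integrable (by norm_num)
  set B : ℕ → ℝ := fun t ↦ (∫ ω, clippedThreshold r (Δ t) (U t ω) ∂P) * Δ t with hB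
  have hBeq : ∀ t, B t = ∫ ω, clippedThreshold r (Δ t) (U t ω) * Δ t ∂P := fun t ↦
    (integral_mul_const _ _).symm
  have hBnonneg : ∀ t, 0 ≤ B t := fun t ↦ by
    rw [hBeq]; exact integral_nonneg fun ω ↦ clippedThreshold_mul_nonneg hr _ _
  have hBlow : ∀ t, 30 * r ≤ |Δ t| → 29 / 30 * Δ t ^ 2 ≤ B t := fun t ht ↦ by
    have h := integral_mono (μ := P) (integrable_const (29 / 30 * Δ t ^ 2))
      ((hCint t).mul_const (Δ t)) fun ω ↦ le_clippedThreshold_mul hr ht (U t ω)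
    rw [hBeq]
    simpa using h
  have hCsq : ∀ t, ∫ ω, clippedThreshold r (Δ t) (U t ω) ^ 2 ∂P ≤ 29 / 28 * B t := fun t ↦ by
    have h := integral_mono (μ := P) (hCL t).integrable_sq
      (((hCint t).mul_const (Δ t)).const_mul (29 / 28)) fun ω ↦ clippedThreshold_sq_le hr _ (U t ω)
    rw [integral_const_mul, ← hBeq] at h
    exact h
  have hCvar : ∀ t, Var[fun ω ↦ clippedThreshold r (Δ t) (U t ω); P] ≤ 961 * r ^ 2 := fun t ↦ by
    obtain ⟨c, hc⟩ := exists_clippedThreshold_mem_Icc hr (Δ t)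
    refine (variance_le_sq_of_bounded (Filter.Eventually.of_forall fun ω ↦ hc (U t ω))
      (hCL t).1.aemeasurable).trans_eq ?_
    ring
  set S := ∑ t ∈ H, Δ t ^ 2 + ∑ t ∈ M, B t with hS
  have hSlow : ∑ t ∈ H, Δ t ^ 2 + 29 / 30 * ∑ t ∈ M with 30 * r ≤ |Δ t|, Δ t ^ 2 ≤ S := by
    rw [hS, Finset.mul_sum]
    gcongr
    calc ∑ t ∈ M with 30 * r ≤ |Δ t|, 29 / 30 * Δ t ^ 2
        ≤ ∑ t ∈ M with 30 * r ≤ |Δ t|, B t :=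
          Finset.sum_le_sum fun t ht ↦ hBlow t (Finset.mem_filter.1 ht).2
      _ ≤ ∑ t ∈ M, B t :=
          Finset.sum_le_sum_of_subset_of_nonneg (Finset.filter_subset _ _) fun t _ _ ↦ hBnonneg t
  have hSsum : ∑ t ∈ H ∪ M, (∫ ω, F t (U t ω) ∂P) * Δ t = S := by
    rw [Finset.sum_union hHM, hS]
    congr 1
    · refine Finset.sum_congr rfl fun t ht ↦ ?_
      simp only [hFH t ht, id, hUmean]; ring
    · refine Finset.sum_congr rfl fun t ht ↦ ?_
      simp only [hFM t ht, hB]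
  have hmain : P.real {ω | ∑ t ∈ H ∪ M, F t (U t ω) * W t ω ≤ 0} ≤ 33 / 133 := by
    have hrat : (33 / 133 : ℝ) = (33 / 100) / (1 + 33 / 100) := by norm_num
    rw [hrat]
    refine measureReal_sum_mul_nonpos_le hFmeas ?_ hW hWmean hWvar hUW hpair (by norm_num) ?_ ?_
    · intro t ht
      rcases Finset.mem_union.1 ht with ht | ht
      · simpa only [hFH t ht, id] using hUL t
      · simpa only [hFM t ht] using hCL t
    · rw [hSsum]; exact hpos.trans_le hSlow
    · rw [hSsum]
      refine le_trans ?_ (hnum S hSlow)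
      rw [Finset.sum_union hHM]
      have h1 : ∑ t ∈ H, (σ2 * ∫ ω, F t (U t ω) ^ 2 ∂P
          + Var[fun ω ↦ F t (U t ω); P] * (Δ t / 2) ^ 2)
          = σ2 * (∑ t ∈ H, Δ t ^ 2 + H.card * τ2) + τ2 / 4 * ∑ t ∈ H, Δ t ^ 2 := by
        have : ∀ t ∈ H, σ2 * ∫ ω, F t (U t ω) ^ 2 ∂P
            + Var[fun ω ↦ F t (U t ω); P] * (Δ t / 2) ^ 2
            = σ2 * (Δ t ^ 2 + τ2) + τ2 / 4 * Δ t ^ 2 := fun t ht ↦ by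
          have h2 : Var[fun ω ↦ U t ω; P] = τ2 := hUvar t
          simp only [hFH t ht, id, hUsq, h2]; ring
        rw [Finset.sum_congr rfl this, Finset.sum_add_distrib, ← Finset.mul_sum, ← Finset.mul_sum,
          Finset.sum_add_distrib]
        simp
      have h2 : ∑ t ∈ M, (σ2 * ∫ ω, F t (U t ω) ^ 2 ∂P
          + Var[fun ω ↦ F t (U t ω); P] * (Δ t / 2) ^ 2)
          ≤ σ2 * (29 / 28 * ∑ t ∈ M, B t) + 961 * r ^ 2 / 4 * ∑ t ∈ M, Δ t ^ 2 := by
        rw [Finset.mul_sum, Finset.mul_sum, Finset.mul_sum, ← Finset.sum_add_distrib]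
        refine Finset.sum_le_sum fun t ht ↦ ?_
        simp only [hFM t ht]
        have h3 := mul_le_mul_of_nonneg_left (hCsq t) hσ
        have h4 := mul_le_mul_of_nonneg_right (hCvar t) (sq_nonneg (Δ t / 2))
        linarith
      have h5 : 0 ≤ σ2 * ∑ t ∈ H, Δ t ^ 2 := by positivity
      rw [h1, hS]
      linarith
  have hbad : P.real (⋃ t ∈ M, {ω | r < |U t ω - Δ t|})
      ≤ M.card * (2 * Real.exp (-r ^ 2 / (2 * τ2))) := by
    calc P.real (⋃ t ∈ M, {ω | r < |U t ω - Δ t|})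
        ≤ ∑ t ∈ M, P.real {ω | r < |U t ω - Δ t|} := measureReal_biUnion_finset_le _ _
      _ ≤ ∑ t ∈ M, 2 * Real.exp (-r ^ 2 / (2 * τ2)) := Finset.sum_le_sum fun t _ ↦
          measureReal_abs_sub_gt_le_of_hasLaw_gaussianReal (hU t) hr.le
      _ = _ := by simp
  have hsub : {ω | ∑ t ∈ H, U t ω * W t ω
        + ∑ t ∈ M, hardThreshold (29 * r) (U t ω) * W t ω ≤ 0}
      ⊆ {ω | ∑ t ∈ H ∪ M, F t (U t ω) * W t ω ≤ 0} ∪ ⋃ t ∈ M, {ω | r < |U t ω - Δ t|} := by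
    intro ω hω
    by_cases hbad : ω ∈ ⋃ t ∈ M, {ω | r < |U t ω - Δ t|}
    · exact Or.inr hbad
    · refine Or.inl ?_
      simp only [Set.mem_iUnion, Set.mem_ofPred_eq, not_exists, not_lt] at hbad hω ⊢
      rw [Finset.sum_union hHM]
      convert hω using 2
      · exact Finset.sum_congr rfl fun t ht ↦ by rw [hFH t ht, id]
      · exact Finset.sum_congr rfl fun t ht ↦ by
          rw [hFM t ht, clippedThreshold_eq_hardThreshold (hbad t ht)]
  calc _ ≤ _ := measureReal_mono hsub
    _ ≤ _ := measureReal_union_le _ _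
    _ ≤ _ := add_le_add hmain hbad

end ThresholdedStatistic

lemma sum_le_one_of_tsum_ofReal_le_one {f : ℕ → ℝ} (hf : ∀ t, 0 ≤ f t)
    (h : ∑' t, ENNReal.ofReal (f t) ≤ 1) (s : Finset ℕ) : ∑ t ∈ s, f t ≤ 1 := by
  have := (ENNReal.sum_le_tsum (f := fun t ↦ ENNReal.ofReal (f t)) s).trans h
  rwa [← ENNReal.ofReal_sum_of_nonneg fun t _ ↦ hf t, ENNReal.ofReal_le_one] at this

lemma half_abs_sub_rpow_le {p a u v : ℝ} (hp : 1 ≤ p) (ha : 0 < a) :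
    (|u - v| / (2 * a)) ^ p ≤ 1 / 2 * (|u| ^ p / a ^ p) + 1 / 2 * (|v| ^ p / a ^ p) := by
  have hconv := (convexOn_rpow hp).2 (x := |u| / a) (y := |v| / a)
    (Set.mem_Ici.2 (by positivity)) (Set.mem_Ici.2 (by positivity))
    (by norm_num : (0 : ℝ) ≤ 1 / 2) (by norm_num : (0 : ℝ) ≤ 1 / 2) (by norm_num)
  simp only [smul_eq_mul] at hconv
  rw [← Real.div_rpow (abs_nonneg _) ha.le, ← Real.div_rpow (abs_nonneg _) ha.le]
  refine le_trans (Real.rpow_le_rpow (by positivity) ?_ (by linarith)) hconv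
  have : 1 / 2 * (|u| / a) + 1 / 2 * (|v| / a) = (|u| + |v|) / (2 * a) := by field_simp
  rw [this]
  gcongr
  exact abs_sub u v

section Body

variable {p : ℝ} {a x : ℕ → ℝ}

lemma sq_le_of_sum_rpow_le_one (hp1 : 1 ≤ p) (hp2 : p ≤ 2) (ha : Antitone a) (ha0 : ∀ t, 0 < a t)
    (hx : ∀ s : Finset ℕ, ∑ t ∈ s, (|x t| / (2 * a t)) ^ p ≤ 1) {K t : ℕ} (hK : K ≤ t) :
    x t ^ 2 ≤ 4 * a K ^ 2 * (|x t| / (2 * a t)) ^ p := by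
  have ht := ha0 t
  have hy0 : 0 ≤ |x t| / (2 * a t) := by positivity
  have hy1 : |x t| / (2 * a t) ≤ 1 := by
    have := hx {t}
    rw [Finset.sum_singleton] at this
    by_contra! h
    exact absurd (Real.one_lt_rpow h (by linarith)) (not_lt.2 this)
  have hsq : (|x t| / (2 * a t)) ^ 2 ≤ (|x t| / (2 * a t)) ^ p := by
    rw [← Real.rpow_two]
    exact Real.rpow_le_rpow_of_exponent_ge' hy0 hy1 (by linarith) hp2
  calc x t ^ 2 = 4 * a t ^ 2 * (|x t| / (2 * a t)) ^ 2 := by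
        rw [div_pow, sq_abs]; field_simp; ring
    _ ≤ 4 * a K ^ 2 * (|x t| / (2 * a t)) ^ p := by
        have := ha hK
        gcongr

lemma sum_sq_le_of_sum_rpow_le_one (hp1 : 1 ≤ p) (hp2 : p ≤ 2) (ha : Antitone a)
    (ha0 : ∀ t, 0 < a t) (hx : ∀ s : Finset ℕ, ∑ t ∈ s, (|x t| / (2 * a t)) ^ p ≤ 1)
    {K : ℕ} {s : Finset ℕ} (hK : ∀ t ∈ s, K ≤ t) :
    ∑ t ∈ s, x t ^ 2 ≤ 4 * a K ^ 2 := by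
  calc ∑ t ∈ s, x t ^ 2 ≤ ∑ t ∈ s, 4 * a K ^ 2 * (|x t| / (2 * a t)) ^ p :=
        Finset.sum_le_sum fun t ht ↦ sq_le_of_sum_rpow_le_one hp1 hp2 ha ha0 hx (hK t ht)
    _ = 4 * a K ^ 2 * ∑ t ∈ s, (|x t| / (2 * a t)) ^ p := by rw [Finset.mul_sum]
    _ ≤ 4 * a K ^ 2 * 1 := by gcongr; exact hx s
    _ = _ := mul_one _

lemma sum_sq_le_of_abs_le (hp1 : 1 ≤ p) (hp2 : p ≤ 2) (ha : Antitone a)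
    (ha0 : ∀ t, 0 < a t) (hx : ∀ s : Finset ℕ, ∑ t ∈ s, (|x t| / (2 * a t)) ^ p ≤ 1)
    {K : ℕ} {s : Finset ℕ} (hK : ∀ t ∈ s, K ≤ t) {R : ℝ} (hR0 : 0 ≤ R)
    (hR : ∀ t ∈ s, |x t| ≤ R) :
    ∑ t ∈ s, x t ^ 2 ≤ R ^ (2 - p) * (2 * a K) ^ p := by
  have hterm : ∀ t ∈ s, x t ^ 2 ≤ R ^ (2 - p) * (2 * a K) ^ p * (|x t| / (2 * a t)) ^ p := by
    intro t ht
    have h0 := ha0 t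
    have hpow : x t ^ 2 = |x t| ^ (2 - p) * |x t| ^ p := by
      rw [← Real.rpow_add_of_nonneg (abs_nonneg _) (by linarith) (by linarith)]
      simp
    have hsplit : |x t| ^ p = (2 * a t) ^ p * (|x t| / (2 * a t)) ^ p := by
      rw [← Real.mul_rpow (by positivity) (by positivity)]
      congr 1
      field_simp
    rw [hpow, mul_assoc, hsplit]
    have h1 := Real.rpow_le_rpow (abs_nonneg _) (hR t ht) (by linarith : 0 ≤ 2 - p)
    have h2 : (2 * a t) ^ p ≤ (2 * a K) ^ p :=
      Real.rpow_le_rpow (by positivity) (by linarith [ha (hK t ht)]) (by linarith)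
    have h3 : 0 ≤ R ^ (2 - p) := Real.rpow_nonneg hR0 _
    gcongr
  have hc : 0 ≤ R ^ (2 - p) * (2 * a K) ^ p :=
    mul_nonneg (Real.rpow_nonneg hR0 _) (Real.rpow_nonneg (by linarith [ha0 K]) _)
  calc ∑ t ∈ s, x t ^ 2
      ≤ ∑ t ∈ s, R ^ (2 - p) * (2 * a K) ^ p * (|x t| / (2 * a t)) ^ p := Finset.sum_le_sum hterm
    _ = R ^ (2 - p) * (2 * a K) ^ p * ∑ t ∈ s, (|x t| / (2 * a t)) ^ p := by rw [Finset.mul_sum]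
    _ ≤ R ^ (2 - p) * (2 * a K) ^ p * 1 := by gcongr; exact hx s
    _ = _ := mul_one _

lemma norm_sq_le_sum_range_add (hp1 : 1 ≤ p) (hp2 : p ≤ 2) (ha : Antitone a)
    (ha0 : ∀ t, 0 < a t) {θ : SeqL2}
    (hx : ∀ s : Finset ℕ, ∑ t ∈ s, (|θ t| / (2 * a t)) ^ p ≤ 1) (K : ℕ) :
    ‖θ‖ ^ 2 ≤ ∑ t ∈ Finset.range K, θ t ^ 2 + 4 * a K ^ 2 := by
  have hnorm := lp.norm_rpow_eq_tsum (p := 2) (by norm_num) θ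
  simp only [ENNReal.toReal_ofNat, Real.rpow_two, Real.norm_eq_abs, sq_abs] at hnorm
  rw [hnorm]
  refine Real.tsum_le_of_sum_le (fun t ↦ sq_nonneg _) fun s ↦ ?_
  rw [← Finset.sum_filter_add_sum_filter_not s (· < K)]
  refine add_le_add ?_ ?_
  · refine Finset.sum_le_sum_of_subset_of_nonneg ?_ fun t _ _ ↦ sq_nonneg _
    intro t ht
    simpa using (Finset.mem_filter.1 ht).2
  · refine sum_sq_le_of_sum_rpow_le_one hp1 hp2 ha ha0 hx fun t ht ↦ ?_
    simpa using (Finset.mem_filter.1 ht).2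

end Body

/-- A weight that is both small at noise level `n` and large compared to the separation forces
the sample size to be large. -/
lemma le_mul_of_rpow_mul_rpow_lt {p b e ν c N B : ℝ} (hp1 : 1 ≤ p) (hp2 : p ≤ 2) (hb : 0 < b)
    (he : 0 < e) (hν : 0 < ν) (hc : 0 < c) (hN : 0 < N) (hB : 0 < B)
    (hbc : c * e ≤ b ^ 2) (hsmall : b ^ p * ν ^ ((p - 2) / 2) < e / B) (hcN : 1 ≤ c * N)
    (hNB : N ≤ c * B ^ 2) : N ≤ ν * e := by
  by_contra! h
  have hbp : (c * e) ^ (p / 2) ≤ b ^ p := by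
    have := Real.rpow_le_rpow (by positivity) hbc (by linarith : 0 ≤ p / 2)
    rwa [← Real.rpow_two, ← Real.rpow_mul hb.le, show 2 * (p / 2) = p by ring] at this
  have hνp : (N / e) ^ ((p - 2) / 2) ≤ ν ^ ((p - 2) / 2) :=
    Real.rpow_le_rpow_of_nonpos hν ((lt_div_iff₀ he).2 h).le (by linarith)
  have hprod : (c * e) ^ (p / 2) * (N / e) ^ ((p - 2) / 2) = e / N * (c * N) ^ (p / 2) := by
    rw [show (p - 2) / 2 = p / 2 - 1 by ring, Real.rpow_sub_one (by positivity),
      Real.mul_rpow hc.le he.le, Real.div_rpow hN.le he.le, Real.mul_rpow hc.le hN.le]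
    have : e ^ (p / 2) ≠ 0 := by positivity
    field_simp
  have hroot : √(c * N) ≤ (c * N) ^ (p / 2) := by
    rw [Real.sqrt_eq_rpow]
    exact Real.rpow_le_rpow_of_exponent_le hcN (by linarith)
  have hlow : N / B ≤ √(c * N) := by
    apply Real.le_sqrt_of_sq_le
    rw [div_pow, div_le_iff₀ (by positivity)]
    nlinarith
  have hfin : e / B ≤ b ^ p * ν ^ ((p - 2) / 2) :=
    calc e / B = e / N * (N / B) := by field_simp
      _ ≤ e / N * (c * N) ^ (p / 2) := by gcongr; exact hlow.trans hroot
      _ = (c * e) ^ (p / 2) * (N / e) ^ ((p - 2) / 2) := hprod.symm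
      _ ≤ _ := by gcongr
  exact absurd hsmall (not_lt.2 hfin)

/-- The energy lost by thresholding at level `30 √(8 L / n)`. -/
lemma threshold_loss_le {p b e ν L : ℝ} (hp1 : 1 ≤ p) (hb : 0 < b)
    (he : 0 < e) (hν : 0 < ν) (hL : 4.85 ≤ L)
    (hsmall : b ^ p * ν ^ ((p - 2) / 2) < e / (5184 * L)) :
    (30 * √(8 * L / ν)) ^ (2 - p) * (2 * b) ^ p ≤ 15 / 1000 * e := by
  have hL0 : 0 < L := by linarith
  have hR : (30 * √(8 * L / ν)) ^ (2 - p) = (7200 * L) ^ (1 - p / 2) * ν ^ ((p - 2) / 2) := by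
    have h1 : 30 * √(8 * L / ν) = (7200 * L / ν) ^ (1 / 2 : ℝ) := by
      rw [← Real.sqrt_eq_rpow, show 7200 * L / ν = 30 ^ 2 * (8 * L / ν) by ring,
        Real.sqrt_mul (by norm_num), Real.sqrt_sq (by norm_num)]
    rw [h1, ← Real.rpow_mul (by positivity), Real.div_rpow (by positivity) hν.le,
      show (p - 2) / 2 = -(1 / 2 * (2 - p)) by ring, Real.rpow_neg hν.le, div_eq_mul_inv,
      show 1 / 2 * (2 - p) = 1 - p / 2 by ring]
  have h2 : (2 : ℝ) ^ p = 4 ^ (p / 2) := by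
    rw [show (4 : ℝ) = 2 ^ (2 : ℝ) by norm_num, ← Real.rpow_mul (by norm_num)]
    congr 1; ring
  have hA : (7200 * L) ^ (1 - p / 2) * 4 ^ (p / 2) ≤ 2 * √(7200 * L) := by
    have h3 : (7200 * L) ^ (1 - p / 2) * 4 ^ (p / 2) = 7200 * L * (4 / (7200 * L)) ^ (p / 2) := by
      rw [Real.rpow_sub (by positivity), Real.rpow_one, Real.div_rpow (by norm_num) (by positivity)]
      ring
    have h4 : (4 / (7200 * L)) ^ (p / 2) ≤ (4 / (7200 * L)) ^ (1 / 2 : ℝ) := by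
      refine Real.rpow_le_rpow_of_exponent_ge (by positivity) ?_ (by linarith)
      rw [div_le_one (by positivity)]
      linarith
    rw [h3]
    refine (mul_le_mul_of_nonneg_left h4 (by positivity)).trans_eq ?_
    rw [← Real.sqrt_eq_rpow, Real.sqrt_div (by norm_num), show (4 : ℝ) = 2 ^ 2 by norm_num,
      Real.sqrt_sq (by norm_num)]
    have : 0 < √(7200 * L) := Real.sqrt_pos.2 (by positivity)
    field_simp
    rw [Real.sq_sqrt (by positivity)]
  have hS : 186 * √(7200 * L) ≤ 7200 * L := by
    have h5 : 186 ≤ √(7200 * L) := Real.le_sqrt_of_sq_le (by linarith)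
    nlinarith [Real.sq_sqrt (show 0 ≤ 7200 * L by positivity)]
  have hb0 : 0 ≤ b ^ p * ν ^ ((p - 2) / 2) := by positivity
  calc (30 * √(8 * L / ν)) ^ (2 - p) * (2 * b) ^ p
      = (7200 * L) ^ (1 - p / 2) * 4 ^ (p / 2) * (b ^ p * ν ^ ((p - 2) / 2)) := by
        rw [hR, Real.mul_rpow (by norm_num) hb.le, h2]; ring
    _ ≤ 2 * (7200 * L / 186) * (e / (5184 * L)) := by
        refine mul_le_mul (hA.trans ?_) hsmall.le hb0 (by positivity)
        linarith
    _ ≤ 15 / 1000 * e := by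
        have : 2 * (7200 * L / 186) * (e / (5184 * L)) = 2 * 7200 / (186 * 5184) * e := by
          field_simp
        rw [this]
        linarith

/-- Signal-to-noise bound when the separation is entirely carried by the low frequencies. -/
lemma noise_le_of_low_frequency {A B e d S h : ℝ} (he : 0 < e)
    (hA : A ≤ e / 32) (hB : B ≤ e / 32)
    (hAB : d * A * B ≤ e ^ 2 / 512) (hBB : d * B ^ 2 ≤ e ^ 2 / 1024)
    (hS : 9 / 10 * e ≤ S) (hh0 : 0 ≤ h) (hh : h ≤ S) :
    (A + B / 2) * (29 / 28 * S + d * (2 * B)) + 2 * B / 4 * h ≤ 33 / 100 * (S / 2) ^ 2 := by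
  have hS0 : 0 < S := by linarith
  have h1 : A * S ≤ e / 32 * S := by gcongr
  have h2 : B * S ≤ e / 32 * S := by gcongr
  have h3 : B * h ≤ e / 32 * S := by gcongr
  have h4 : e * S ≤ 10 / 9 * S * S := by gcongr; linarith
  have h5 : e ^ 2 ≤ (10 / 9 * S) ^ 2 := by gcongr; linarith
  nlinarith

/-- Signal-to-noise bound when high frequencies are thresholded and the samples are plentiful. -/
lemma noise_le_of_large_sample {A B e d S h Q ρ : ℝ} (he : 0 < e)
    (hA : A ≤ e / 32) (hB : B ≤ e / 10 ^ 6)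
    (hAB : d * A * B ≤ e ^ 2 / 512) (hBB : d * B ^ 2 ≤ e ^ 2 / 1024)
    (hS : 522 / 1000 * e ≤ S) (hh0 : 0 ≤ h) (hh : h ≤ S)
    (hQ : ρ * Q ≤ 1 / 1000 * e * (30 / 29 * S + 15 / 1000 * e)) :
    (A + B / 2) * (29 / 28 * S + d * (2 * B)) + 2 * B / 4 * h + ρ / 4 * Q
      ≤ 33 / 100 * (S / 2) ^ 2 := by
  have hS0 : 0 < S := by linarith
  have h1 : A * S ≤ e / 32 * S := by gcongr
  have h2 : B * S ≤ e / 10 ^ 6 * S := by gcongr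
  have h3 : B * h ≤ e / 10 ^ 6 * S := by gcongr
  have h4 : e * S ≤ 1000 / 522 * S * S := by gcongr; linarith
  have h5 : e ^ 2 ≤ (1000 / 522 * S) ^ 2 := by gcongr; linarith
  nlinarith

/-- Deterministic analysis of the thresholded statistic: the retained energy is positive and
dominates the noise. -/
lemma signal_dominates_noise {p : ℝ} (hp1 : 1 ≤ p) (hp2 : p ≤ 2) {a x : ℕ → ℝ} (ha : Antitone a)
    (ha0 : ∀ t, 0 < a t) (hx : ∀ s : Finset ℕ, ∑ t ∈ s, (|x t| / (2 * a t)) ^ p ≤ 1)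
    {ε μ ν L : ℝ} (hε : 0 < ε) (hμ : 0 < μ) (hν : 0 < ν) (hL : 4.85 ≤ L)
    (hsep : ∀ K, ε ^ 2 ≤ ∑ t ∈ Finset.range K, x t ^ 2 + 4 * a K ^ 2) {d N : ℕ}
    (hsmall : a d ^ p * ν ^ ((p - 2) / 2) < ε ^ 2 / (5184 * L))
    (hN : a N ≤ ε / 3) (hNmin : d < N → ε / 3 < a d)
    (hm : 32 ≤ μ * ε ^ 2) (hn : 32 * √d ≤ ν * ε ^ 2) (hmn : 512 * d ≤ μ * ν * ε ^ 4) :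
    0 < ∑ t ∈ Finset.range d, x t ^ 2
        + 29 / 30 * ∑ t ∈ Finset.Ico d N with 30 * √(8 * L / ν) ≤ |x t|, x t ^ 2 ∧
    ∀ S, ∑ t ∈ Finset.range d, x t ^ 2
        + 29 / 30 * ∑ t ∈ Finset.Ico d N with 30 * √(8 * L / ν) ≤ |x t|, x t ^ 2 ≤ S →
      (μ⁻¹ + ν⁻¹ / 2) * (29 / 28 * S + d * (2 * ν⁻¹)) + 2 * ν⁻¹ / 4 * ∑ t ∈ Finset.range d, x t ^ 2
        + 961 * √(8 * L / ν) ^ 2 / 4 * ∑ t ∈ Finset.Ico d N, x t ^ 2 ≤ 33 / 100 * (S / 2) ^ 2 := by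
  set e := ε ^ 2 with he
  have he0 : 0 < e := by positivity
  have hL0 : 0 < L := by linarith
  have hA : μ⁻¹ ≤ e / 32 := by
    rw [inv_le_iff_one_le_mul₀ hμ]; linarith
  have hAB : d * μ⁻¹ * ν⁻¹ ≤ e ^ 2 / 512 := by
    have : e ^ 2 = ε ^ 4 := by rw [he]; ring
    rw [this, mul_assoc, ← mul_inv, ← div_eq_mul_inv, div_le_iff₀ (by positivity)]
    linarith
  have hBB : d * ν⁻¹ ^ 2 ≤ e ^ 2 / 1024 := by
    have h1 : (32 * √(d : ℝ)) ^ 2 ≤ (ν * e) ^ 2 := by gcongr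
    rw [mul_pow, Real.sq_sqrt (Nat.cast_nonneg d)] at h1
    rw [inv_pow, ← div_eq_mul_inv, div_le_iff₀ (by positivity)]
    linarith
  have hinv : ∀ c : ℝ, 0 < c → c ≤ ν * e → ν⁻¹ ≤ e / c := by
    intro c hc h
    rw [inv_le_iff_one_le_mul₀ hν, ← mul_div_right_comm, one_le_div hc]
    linarith
  set h := ∑ t ∈ Finset.range d, x t ^ 2 with hh
  have hh0 : 0 ≤ h := Finset.sum_nonneg fun t _ ↦ sq_nonneg _
  rcases lt_or_ge d N with hdN | hNd
  · have had := hNmin hdN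
    have hcase : (1728 * L) ^ 2 ≤ ν * e := by
      refine le_mul_of_rpow_mul_rpow_lt (c := 1 / 9) (B := 5184 * L) hp1 hp2 (ha0 d) he0 hν
        (by norm_num) (by positivity) (by positivity) ?_ hsmall (by nlinarith) ?_
      · have : (ε / 3) ^ 2 ≤ a d ^ 2 := by gcongr
        rw [he]; linarith
      · apply le_of_eq; ring
    have hbig : 10 ^ 6 ≤ ν * e := by nlinarith
    set M := Finset.Ico d N with hM
    have hsplit : ∑ t ∈ Finset.range N, x t ^ 2 = h + ∑ t ∈ M, x t ^ 2 := by
      rw [hh, hM, Finset.sum_range_add_sum_Ico _ hdN.le]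
    have hfilt := Finset.sum_filter_add_sum_filter_not M (fun t ↦ 30 * √(8 * L / ν) ≤ |x t|)
      (fun t ↦ x t ^ 2)
    have hloss : ∑ t ∈ M with ¬ 30 * √(8 * L / ν) ≤ |x t|, x t ^ 2 ≤ 15 / 1000 * e := by
      refine (sum_sq_le_of_abs_le (R := 30 * √(8 * L / ν)) (K := d) hp1 hp2 ha ha0 hx
        (fun t ht ↦ ?_) (by positivity) fun t ht ↦ ?_).trans
        (threshold_loss_le hp1 (ha0 d) he0 hν hL hsmall)
      · exact (Finset.mem_Ico.1 (Finset.mem_filter.1 ht).1).1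
      · exact (not_le.1 (Finset.mem_filter.1 ht).2).le
    set q := ∑ t ∈ M with 30 * √(8 * L / ν) ≤ |x t|, x t ^ 2 with hq
    have hq0 : 0 ≤ q := Finset.sum_nonneg fun t _ ↦ sq_nonneg _
    have htail : 4 * a N ^ 2 ≤ 4 / 9 * e := by
      have : a N ^ 2 ≤ (ε / 3) ^ 2 := by have := ha0 N; gcongr
      rw [he]; linarith
    have hs := hsep N
    have hS0 : 522 / 1000 * e ≤ h + 29 / 30 * q := by linarith
    refine ⟨by linarith, fun S hS ↦ ?_⟩
    refine noise_le_of_large_sample he0 hA (hinv _ (by norm_num) hbig) hAB hBB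
      (hS0.trans hS) hh0 (by linarith) ?_
    rw [Real.sq_sqrt (by positivity)]
    have hρ : 961 * (8 * L / ν) ≤ 1 / 1000 * e := by
      rw [mul_div_assoc', div_le_iff₀ hν]
      nlinarith
    have hQ0 : 0 ≤ ∑ t ∈ M, x t ^ 2 := Finset.sum_nonneg fun t _ ↦ sq_nonneg _
    refine mul_le_mul hρ (by linarith) hQ0 (by positivity)
  · rw [Finset.Ico_eq_empty (by omega)]
    simp only [Finset.filter_empty, Finset.sum_empty, mul_zero, add_zero]
    have hs := hsep d
    by_cases hcase : 4 * a d ^ 2 ≤ 1 / 10 * e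
    · have hh9 : 9 / 10 * e ≤ h := by linarith
      have hd : 1 ≤ d := by
        by_contra! hd
        have : d = 0 := by omega
        subst this
        simp [hh] at hh9
        linarith
      have hB : 32 ≤ ν * e := by
        have : (1 : ℝ) ≤ √d := Real.one_le_sqrt.2 (by exact_mod_cast hd)
        linarith
      refine ⟨by linarith, fun S hS ↦ ?_⟩
      exact noise_le_of_low_frequency he0 hA (hinv _ (by norm_num) hB) hAB hBB
        (hh9.trans hS) hh0 hS
    · push Not at hcase
      have hbig : 10 ^ 6 ≤ ν * e := by
        refine le_mul_of_rpow_mul_rpow_lt (c := 1 / 40) (B := 5184 * L) hp1 hp2 (ha0 d) he0 hν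
          (by norm_num) (by norm_num) (by positivity) (by linarith) hsmall (by norm_num) ?_
        nlinarith
      have htail : 4 * a d ^ 2 ≤ 4 / 9 * e := by
        have : a d ^ 2 ≤ (ε / 3) ^ 2 := by
          have := ha0 d
          have := (ha hNd).trans hN
          gcongr
        rw [he]; linarith
      refine ⟨by linarith, fun S hS ↦ ?_⟩
      have := noise_le_of_large_sample (ρ := 0) (Q := 0) he0 hA
        (hinv _ (by norm_num) hbig) hAB hBB (by linarith) hh0 hS
        (by rw [mul_zero]; have : 0 < S := by linarith
            positivity)
      simpa using this

section GaussianTriple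

variable {Ω : Type*} {mΩ : MeasurableSpace Ω} {P : Measure Ω} {X Y Z : Ω → ℝ}
  {μX μY μZ : ℝ} {v w : NNReal}

lemma hasLaw_sub_of_indepFun (hX : HasLaw X (gaussianReal μX v) P)
    (hY : HasLaw Y (gaussianReal μY w) P) (hXY : IndepFun X Y P) :
    HasLaw (fun ω ↦ X ω - Y ω) (gaussianReal (μX - μY) (v + w)) P := by
  have hY' := gaussianReal_neg hY
  refine ⟨hX.aemeasurable.sub hY.aemeasurable, ?_⟩
  have hind : IndepFun X (fun ω ↦ -Y ω) P := hXY.comp measurable_id measurable_neg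
  have := gaussianReal_add_gaussianReal_of_indepFun hind hX.map_eq hY'.map_eq
  simpa [sub_eq_add_neg, Pi.add_def] using this

lemma integral_contrast (hX : HasLaw X (gaussianReal μX v) P) (hY : HasLaw Y (gaussianReal μY v) P)
    (hZ : HasLaw Z (gaussianReal μZ w) P) :
    ∫ ω, (Z ω - (X ω + Y ω) / 2) ∂P = μZ - (μX + μY) / 2 := by
  have iX := hX.hasGaussianLaw.integrable
  have iY := hY.hasGaussianLaw.integrable
  have iZ := hZ.hasGaussianLaw.integrable
  have iXY : Integrable (fun ω ↦ (X ω + Y ω) / 2) P := (iX.add iY).div_const 2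
  rw [integral_sub iZ iXY, integral_div, integral_add iX iY,
    hX.integral_eq, hY.integral_eq, hZ.integral_eq]
  simp

lemma variance_of_hasLaw_gaussianReal (hX : HasLaw X (gaussianReal μX v) P) : Var[X; P] = v := by
  rw [hX.variance_eq, variance_id_gaussianReal]

lemma variance_contrast (hX : HasLaw X (gaussianReal μX v) P) (hY : HasLaw Y (gaussianReal μY v) P)
    (hZ : HasLaw Z (gaussianReal μZ w) P) (hXYZ : IndepFun X (fun ω ↦ (Y ω, Z ω)) P)
    (hYZ : IndepFun Y Z P) :
    Var[fun ω ↦ Z ω - (X ω + Y ω) / 2; P] = w + v / 2 := by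
  have mX := hX.hasGaussianLaw.memLp_two
  have mY := hY.hasGaussianLaw.memLp_two
  have mZ := hZ.hasGaussianLaw.memLp_two
  have mX' : MemLp (fun ω ↦ (-1 / 2) * X ω) 2 P := mX.const_mul _
  have mY' : MemLp (fun ω ↦ (-1 / 2) * Y ω) 2 P := mY.const_mul _
  have h1 : IndepFun (fun ω ↦ (-1 / 2) * X ω) (fun ω ↦ (-1 / 2) * Y ω + Z ω) P :=
    hXYZ.comp (φ := fun x : ℝ ↦ (-1 / 2) * x) (ψ := fun y : ℝ × ℝ ↦ (-1 / 2) * y.1 + y.2)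
      (by fun_prop) (by fun_prop)
  have h2 : IndepFun (fun ω ↦ (-1 / 2) * Y ω) Z P :=
    hYZ.comp (φ := fun x : ℝ ↦ (-1 / 2) * x) (ψ := id) (by fun_prop) measurable_id
  have hfun : (fun ω ↦ Z ω - (X ω + Y ω) / 2)
      = (fun ω ↦ (-1 / 2) * X ω) + fun ω ↦ (-1 / 2) * Y ω + Z ω := by
    ext ω; simp only [Pi.add_apply]; ring
  have mYZ : MemLp (fun ω ↦ (-1 / 2) * Y ω + Z ω) 2 P := mY'.add mZ
  rw [hfun, h1.variance_add mX' mYZ,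
    show (fun ω ↦ (-1 / 2) * Y ω + Z ω) = (fun ω ↦ (-1 / 2) * Y ω) + Z from rfl,
    h2.variance_add mY' mZ, variance_const_mul, variance_const_mul,
    variance_of_hasLaw_gaussianReal hX, variance_of_hasLaw_gaussianReal hY,
    variance_of_hasLaw_gaussianReal hZ]
  ring

lemma indepFun_difference_contrast (hX : HasLaw X (gaussianReal μX v) P)
    (hY : HasLaw Y (gaussianReal μY v) P) (hZ : HasLaw Z (gaussianReal μZ w) P)
    (hXYZ : IndepFun X (fun ω ↦ (Y ω, Z ω)) P) (hYZ : IndepFun Y Z P) :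
    IndepFun (fun ω ↦ X ω - Y ω) (fun ω ↦ Z ω - (X ω + Y ω) / 2) P := by
  have mX := hX.hasGaussianLaw.memLp_two
  have mY := hY.hasGaussianLaw.memLp_two
  have mZ := hZ.hasGaussianLaw.memLp_two
  have hXY : IndepFun X Y P := hXYZ.comp (φ := id) (ψ := Prod.fst) measurable_id measurable_fst
  have hXZ : IndepFun X Z P := hXYZ.comp (φ := id) (ψ := Prod.snd) measurable_id measurable_snd
  have := hX.hasGaussianLaw.isProbabilityMeasure
  have hjoint := hXYZ.hasGaussianLaw hX.hasGaussianLaw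
    (hYZ.hasGaussianLaw hY.hasGaussianLaw hZ.hasGaussianLaw)
  let x : ℝ × ℝ × ℝ →L[ℝ] ℝ := .fst ℝ ℝ (ℝ × ℝ)
  let y : ℝ × ℝ × ℝ →L[ℝ] ℝ := .comp (.fst ℝ ℝ ℝ) (.snd ℝ ℝ (ℝ × ℝ))
  let z : ℝ × ℝ × ℝ →L[ℝ] ℝ := .comp (.snd ℝ ℝ ℝ) (.snd ℝ ℝ (ℝ × ℝ))
  have hmap := hjoint.map_fun ((x - y).prod (z - (2⁻¹ : ℝ) • (x + y)))
  have hgauss : HasGaussianLaw (fun ω ↦ (X ω - Y ω, Z ω - (X ω + Y ω) / 2)) P := by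
    have hfun : (fun ω ↦ ((x - y).prod (z - (2⁻¹ : ℝ) • (x + y))) (X ω, Y ω, Z ω))
        = fun ω ↦ (X ω - Y ω, Z ω - (X ω + Y ω) / 2) := by
      ext ω
      · simp [x, y]
      · simp [x, y, z]
        ring
    rwa [hfun] at hmap
  refine hgauss.indepFun_of_covariance_eq_zero ?_
  have mXY : MemLp (fun ω ↦ X ω + Y ω) 2 P := mX.add mY
  have mXY2 : MemLp (fun ω ↦ (X ω + Y ω) / 2) 2 P := by
    simpa [div_eq_inv_mul] using mXY.const_mul 2⁻¹
  rw [covariance_fun_sub_fun_sub mX mY mZ mXY2, covariance_fun_div_right, covariance_fun_div_right,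
    show (fun ω ↦ X ω + Y ω) = X + Y from rfl,
    covariance_add_right mX mX mY, covariance_add_right mY mX mY,
    covariance_self hX.aemeasurable, covariance_self hY.aemeasurable,
    hXZ.covariance_eq_zero mX mZ, hYZ.covariance_eq_zero mY mZ, hXY.covariance_eq_zero mX mY,
    hXY.symm.covariance_eq_zero mY mX, variance_of_hasLaw_gaussianReal hX,
    variance_of_hasLaw_gaussianReal hY]
  ring

end GaussianTriple

section SampleMean

instance {E : Type*} [MeasurableSpace E] (n : ℕ) (ν : Measure E) [IsProbabilityMeasure ν] :
    IsProbabilityMeasure (iidSamples n ν) := by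
  unfold iidSamples; infer_instance

/-- The `t`-th coordinate of the empirical mean of a sample. -/
noncomputable def sampleMean (n t : ℕ) (x : Fin n → ℕ → ℝ) : ℝ := (n : ℝ)⁻¹ * ∑ i, x i t

@[fun_prop]
lemma measurable_sampleMean (n t : ℕ) : Measurable (sampleMean n t) := by
  unfold sampleMean
  fun_prop

variable {θ : ℕ → ℝ} {ν : Measure (ℕ → ℝ)} {n : ℕ}

lemma IsGaussianSeq.eq_infinitePi (hν : IsGaussianSeq θ ν) :
    ν = Measure.infinitePi (fun t ↦ gaussianReal (θ t) 1) :=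
  hν.2.unique (Measure.isProjectiveLimit_infinitePi _)

lemma IsGaussianSeq.hasLaw_coord (hν : IsGaussianSeq θ ν) (i : Fin n) (t : ℕ) :
    HasLaw (fun x : Fin n → ℕ → ℝ ↦ x i t) (gaussianReal (θ t) 1) (iidSamples n ν) := by
  have := hν.1
  have hmp : MeasurePreserving (Function.eval i) (iidSamples n ν) ν :=
    measurePreserving_eval (fun _ : Fin n ↦ ν) i
  have h : HasLaw (fun y : ℕ → ℝ ↦ y t) (gaussianReal (θ t) 1) ν :=
    ⟨(measurable_pi_apply t).aemeasurable, by rw [hν.eq_infinitePi, Measure.infinitePi_map_eval]⟩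
  exact h.comp hmp.hasLaw

lemma IsGaussianSeq.iIndepFun_coord (hν : IsGaussianSeq θ ν) :
    iIndepFun (fun (q : Fin n × ℕ) (x : Fin n → ℕ → ℝ) ↦ x q.1 q.2) (iidSamples n ν) := by
  have := hν.1
  refine iIndepFun_uncurry' (X := fun (i : Fin n) (t : ℕ) (x : Fin n → ℕ → ℝ) ↦ x i t)
    (fun i t ↦ by fun_prop) ?_ fun i ↦ ?_
  · exact iIndepFun_pi (X := fun _ : Fin n ↦ (id : (ℕ → ℝ) → ℕ → ℝ)) fun i ↦ aemeasurable_id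
  · have hmp : MeasurePreserving (Function.eval i) (iidSamples n ν) ν :=
      measurePreserving_eval (fun _ : Fin n ↦ ν) i
    rw [iIndepFun_iff_map_fun_eq_infinitePi_map fun t ↦ by fun_prop]
    simp_rw [(hν.hasLaw_coord i _).map_eq]
    rw [← hν.eq_infinitePi]
    exact hmp.map_eq

lemma IsGaussianSeq.indepFun_sampleMean (hν : IsGaussianSeq θ ν) {s t : ℕ} (hst : s ≠ t) :
    IndepFun (sampleMean n s) (sampleMean n t) (iidSamples n ν) := by
  classical
  have h := (hν.iIndepFun_coord (n := n)).indepFun_finset (Finset.univ ×ˢ {s}) (Finset.univ ×ˢ {t})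
    (by rw [Finset.disjoint_product]; right; simpa using hst) (fun q ↦ by fun_prop)
  exact h.comp
    (φ := fun y : (↥(Finset.univ ×ˢ {s} : Finset (Fin n × ℕ)) → ℝ) ↦
      (n : ℝ)⁻¹ * ∑ i : Fin n, y ⟨(i, s), by simp⟩)
    (ψ := fun y : (↥(Finset.univ ×ˢ {t} : Finset (Fin n × ℕ)) → ℝ) ↦
      (n : ℝ)⁻¹ * ∑ i : Fin n, y ⟨(i, t), by simp⟩) (by fun_prop) (by fun_prop)

lemma IsGaussianSeq.hasLaw_sampleMean (hν : IsGaussianSeq θ ν) (hn : 0 < n) (t : ℕ) :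
    HasLaw (sampleMean n t) (gaussianReal (θ t) (n : NNReal)⁻¹) (iidSamples n ν) := by
  have := hν.1
  have hind : iIndepFun (fun (i : Fin n) (x : Fin n → ℕ → ℝ) ↦ x i t) (iidSamples n ν) :=
    (hν.iIndepFun_coord (n := n)).precomp (g := fun i ↦ (i, t)) fun i j h ↦ (Prod.ext_iff.1 h).1
  have hn' : (n : ℝ) ≠ 0 := by positivity
  have hlaw := fun i ↦ hν.hasLaw_coord (n := n) i t
  have hsum := iIndepFun.hasGaussianLaw_fun_sum (fun i ↦ (hlaw i).hasGaussianLaw) hind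
  have hmean : ∫ x, ∑ i : Fin n, x i t ∂(iidSamples n ν) = n * θ t := by
    rw [integral_finsetSum _ fun i _ ↦ (hlaw i).hasGaussianLaw.integrable]
    simp [(hlaw _).integral_eq]
  have hvar : Var[fun x ↦ ∑ i : Fin n, x i t; iidSamples n ν] = n := by
    have := IndepFun.variance_sum (s := Finset.univ) (μ := iidSamples n ν)
      (X := fun (i : Fin n) (x : Fin n → ℕ → ℝ) ↦ x i t)
      (fun i _ ↦ (hlaw i).hasGaussianLaw.memLp_two) (fun i _ j _ hij ↦ hind.indepFun hij)
    rw [← Finset.sum_fn, this]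
    simp [variance_of_hasLaw_gaussianReal (hlaw _)]
  have hS : HasLaw (fun x : Fin n → ℕ → ℝ ↦ ∑ i, x i t) (gaussianReal (n * θ t) n)
      (iidSamples n ν) := by
    refine ⟨hsum.aemeasurable, ?_⟩
    rw [hsum.map_eq_gaussianReal, hmean, hvar]
    simp
  have hlaw_mean := gaussianReal_const_mul hS (n : ℝ)⁻¹
  have hv : (NNReal.mk ((n : ℝ)⁻¹ ^ 2) (sq_nonneg _) * n : NNReal) = (n : NNReal)⁻¹ := by
    apply NNReal.coe_injective
    push_cast
    field_simp
  rwa [hv, inv_mul_cancel_left₀ hn'] at hlaw_mean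

end SampleMean

lemma measurePreserving_prod_prod_comm {α β γ δ : Type*} [MeasurableSpace α] [MeasurableSpace β]
    [MeasurableSpace γ] [MeasurableSpace δ] (μa : Measure α) (μb : Measure β) (μc : Measure γ)
    (μd : Measure δ) [SFinite μa] [SFinite μb] [SFinite μc] [SFinite μd] :
    MeasurePreserving (fun q : (α × β) × γ × δ ↦ ((q.1.1, q.2.1), (q.1.2, q.2.2)))
      ((μa.prod μb).prod (μc.prod μd)) ((μa.prod μc).prod (μb.prod μd)) := by
  have h1 := measurePreserving_prodAssoc μa μb (μc.prod μd)
  have h2 := (measurePreserving_prodAssoc μb μc μd).symm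
  have h3 := (Measure.measurePreserving_swap (μ := μb) (ν := μc)).prod (MeasurePreserving.id μd)
  have h4 := measurePreserving_prodAssoc μc μb μd
  have h5 := (measurePreserving_prodAssoc μa μc (μb.prod μd)).symm
  exact h5.comp (((MeasurePreserving.id μa).prod (h4.comp (h3.comp h2))).comp h1)

lemma IndepFun.prodMk_prod {Ω Ω' β β' γ γ' : Type*} [MeasurableSpace Ω] [MeasurableSpace Ω']
    [MeasurableSpace β] [MeasurableSpace β'] [MeasurableSpace γ] [MeasurableSpace γ']
    {μ : Measure Ω} {ν : Measure Ω'} [IsProbabilityMeasure μ] [IsProbabilityMeasure ν]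
    {f : Ω → β} {f' : Ω → β'} {g : Ω' → γ} {g' : Ω' → γ'}
    (hf : Measurable f) (hf' : Measurable f') (hg : Measurable g) (hg' : Measurable g')
    (hff : IndepFun f f' μ) (hgg : IndepFun g g' ν) :
    IndepFun (fun ω : Ω × Ω' ↦ (f ω.1, g ω.2)) (fun ω : Ω × Ω' ↦ (f' ω.1, g' ω.2))
      (μ.prod ν) := by
  rw [indepFun_iff_map_prod_eq_prod_map_map (by fun_prop) (by fun_prop)]
  have := Measure.isProbabilityMeasure_map (μ := μ) hf.aemeasurable
  have := Measure.isProbabilityMeasure_map (μ := μ) hf'.aemeasurable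
  have := Measure.isProbabilityMeasure_map (μ := ν) hg.aemeasurable
  have := Measure.isProbabilityMeasure_map (μ := ν) hg'.aemeasurable
  have h1 : MeasurePreserving (fun ω ↦ (f ω, f' ω)) μ ((μ.map f).prod (μ.map f')) :=
    ⟨by fun_prop, (indepFun_iff_map_prod_eq_prod_map_map (by fun_prop) (by fun_prop)).1 hff⟩
  have h2 : MeasurePreserving (fun ω ↦ (g ω, g' ω)) ν ((ν.map g).prod (ν.map g')) :=
    ⟨by fun_prop, (indepFun_iff_map_prod_eq_prod_map_map (by fun_prop) (by fun_prop)).1 hgg⟩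
  have hcomm := (measurePreserving_prod_prod_comm (μ.map f) (μ.map f') (ν.map g) (ν.map g')).comp
    (h1.prod h2)
  have e1 : (μ.prod ν).map (fun ω ↦ (f ω.1, g ω.2)) = (μ.map f).prod (ν.map g) :=
    (Measure.map_prod_map μ ν hf hg).symm
  have e2 : (μ.prod ν).map (fun ω ↦ (f' ω.1, g' ω.2)) = (μ.map f').prod (ν.map g') :=
    (Measure.map_prod_map μ ν hf' hg').symm
  rw [e1, e2, ← hcomm.map_eq]
  rfl

section Test

/-- The difference of the `t`-th empirical means of the two reference samples. -/
noncomputable def meanDifference (n m t : ℕ)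
    (ω : (Fin n → ℕ → ℝ) × (Fin n → ℕ → ℝ) × (Fin m → ℕ → ℝ)) : ℝ :=
  sampleMean n t ω.1 - sampleMean n t ω.2.1

/-- The `t`-th empirical mean of the test sample, centred at the midpoint of the reference means. -/
noncomputable def meanContrast (n m t : ℕ)
    (ω : (Fin n → ℕ → ℝ) × (Fin n → ℕ → ℝ) × (Fin m → ℕ → ℝ)) : ℝ :=
  sampleMean m t ω.2.2 - (sampleMean n t ω.1 + sampleMean n t ω.2.1) / 2

/-- The thresholded likelihood-free test statistic: all frequencies in `H` are used, those in `M`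
only when the estimated difference exceeds the level `l`. -/
noncomputable def thresholdStatistic (n m : ℕ) (H M : Finset ℕ) (l : ℝ)
    (ω : (Fin n → ℕ → ℝ) × (Fin n → ℕ → ℝ) × (Fin m → ℕ → ℝ)) : ℝ :=
  ∑ t ∈ H, meanDifference n m t ω * meanContrast n m t ω
    + ∑ t ∈ M, hardThreshold l (meanDifference n m t ω) * meanContrast n m t ω

variable {n m : ℕ}

@[fun_prop]
lemma measurable_meanDifference (t : ℕ) : Measurable (meanDifference n m t) := by
  unfold meanDifference; fun_prop

@[fun_prop]
lemma measurable_meanContrast (t : ℕ) : Measurable (meanContrast n m t) := by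
  unfold meanContrast; fun_prop

lemma measurable_thresholdStatistic (H M : Finset ℕ) (l : ℝ) :
    Measurable (thresholdStatistic n m H M l) := by
  have hM (t : ℕ) : Measurable fun ω ↦ hardThreshold l (meanDifference n m t ω) :=
    (measurable_hardThreshold l).comp (measurable_meanDifference t)
  unfold thresholdStatistic
  fun_prop

lemma measureReal_sign_mul_thresholdStatistic_nonpos_le {θ1 θ2 θ : ℕ → ℝ}
    {ν1 ν2 ν : Measure (ℕ → ℝ)} (h1 : IsGaussianSeq θ1 ν1) (h2 : IsGaussianSeq θ2 ν2)
    (h : IsGaussianSeq θ ν) (hn : 0 < n) (hm : 0 < m) {s : ℝ} (hs : s ^ 2 = 1)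
    (hθ : ∀ t, s * (θ t - (θ1 t + θ2 t) / 2) = (θ1 t - θ2 t) / 2)
    {H M : Finset ℕ} (hHM : Disjoint H M) {r : ℝ} (hr : 0 < r)
    (hpos : 0 < ∑ t ∈ H, (θ1 t - θ2 t) ^ 2
      + 29 / 30 * ∑ t ∈ M with 30 * r ≤ |θ1 t - θ2 t|, (θ1 t - θ2 t) ^ 2)
    (hnum : ∀ S, ∑ t ∈ H, (θ1 t - θ2 t) ^ 2
        + 29 / 30 * ∑ t ∈ M with 30 * r ≤ |θ1 t - θ2 t|, (θ1 t - θ2 t) ^ 2 ≤ S →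
      ((m : ℝ)⁻¹ + (n : ℝ)⁻¹ / 2) * (29 / 28 * S + H.card * (2 * (n : ℝ)⁻¹))
        + 2 * (n : ℝ)⁻¹ / 4 * ∑ t ∈ H, (θ1 t - θ2 t) ^ 2
        + 961 * r ^ 2 / 4 * ∑ t ∈ M, (θ1 t - θ2 t) ^ 2 ≤ 33 / 100 * (S / 2) ^ 2) :
    ((iidSamples n ν1).prod ((iidSamples n ν2).prod (iidSamples m ν))).real
        {ω | s * thresholdStatistic n m H M (29 * r) ω ≤ 0}
      ≤ 33 / 133 + M.card * (2 * Real.exp (-r ^ 2 / (2 * (2 * (n : ℝ)⁻¹)))) := by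
  have := h1.1
  have := h2.1
  have := h.1
  set μ1 := iidSamples n ν1
  set μ2 := iidSamples n ν2
  set μ3 := iidSamples m ν
  have lawX (t : ℕ) : HasLaw (fun ω : (Fin n → ℕ → ℝ) × (Fin n → ℕ → ℝ) × (Fin m → ℕ → ℝ) ↦
      sampleMean n t ω.1) (gaussianReal (θ1 t) (n : NNReal)⁻¹) (μ1.prod (μ2.prod μ3)) :=
    (h1.hasLaw_sampleMean hn t).comp measurePreserving_fst.hasLaw
  have lawY (t : ℕ) : HasLaw (fun ω : (Fin n → ℕ → ℝ) × (Fin n → ℕ → ℝ) × (Fin m → ℕ → ℝ) ↦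
      sampleMean n t ω.2.1) (gaussianReal (θ2 t) (n : NNReal)⁻¹) (μ1.prod (μ2.prod μ3)) :=
    (h2.hasLaw_sampleMean hn t).comp
      (measurePreserving_fst.comp measurePreserving_snd).hasLaw
  have lawZ (t : ℕ) : HasLaw (fun ω : (Fin n → ℕ → ℝ) × (Fin n → ℕ → ℝ) × (Fin m → ℕ → ℝ) ↦
      sampleMean m t ω.2.2) (gaussianReal (θ t) (m : NNReal)⁻¹) (μ1.prod (μ2.prod μ3)) :=
    (h.hasLaw_sampleMean hm t).comp
      (measurePreserving_snd.comp measurePreserving_snd).hasLaw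
  have indXYZ (t : ℕ) : IndepFun
      (fun ω : (Fin n → ℕ → ℝ) × (Fin n → ℕ → ℝ) × (Fin m → ℕ → ℝ) ↦ sampleMean n t ω.1)
      (fun ω ↦ (sampleMean n t ω.2.1, sampleMean m t ω.2.2)) (μ1.prod (μ2.prod μ3)) :=
    indepFun_prod (Y := fun q : (Fin n → ℕ → ℝ) × (Fin m → ℕ → ℝ) ↦
      (sampleMean n t q.1, sampleMean m t q.2)) (by fun_prop) (by fun_prop)
  have indYZ (t : ℕ) : IndepFun
      (fun ω : (Fin n → ℕ → ℝ) × (Fin n → ℕ → ℝ) × (Fin m → ℕ → ℝ) ↦ sampleMean n t ω.2.1)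
      (fun ω ↦ sampleMean m t ω.2.2) (μ1.prod (μ2.prod μ3)) := by
    have hq : IndepFun (fun q : (Fin n → ℕ → ℝ) × (Fin m → ℕ → ℝ) ↦ sampleMean n t q.1)
        (fun q ↦ sampleMean m t q.2) (μ2.prod μ3) := indepFun_prod (by fun_prop) (by fun_prop)
    have hconst : IndepFun (fun _ : Fin n → ℕ → ℝ ↦ (0 : ℝ)) (fun _ : Fin n → ℕ → ℝ ↦ (0 : ℝ)) μ1 :=
      indepFun_const_left _ _
    exact (IndepFun.prodMk_prod (by fun_prop) (by fun_prop) (by fun_prop) (by fun_prop)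
      hconst hq).comp (φ := Prod.snd) (ψ := Prod.snd) measurable_snd measurable_snd
  have hpair (k t : ℕ) (hkt : k ≠ t) : IndepFun
      (fun ω : (Fin n → ℕ → ℝ) × (Fin n → ℕ → ℝ) × (Fin m → ℕ → ℝ) ↦
        (meanDifference n m k ω, s * meanContrast n m k ω))
      (fun ω ↦ (meanDifference n m t ω, s * meanContrast n m t ω)) (μ1.prod (μ2.prod μ3)) := by
    have hX := h1.indepFun_sampleMean (n := n) hkt
    have hY := h2.indepFun_sampleMean (n := n) hkt
    have hZ := h.indepFun_sampleMean (n := m) hkt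
    have hYZ := IndepFun.prodMk_prod (by fun_prop) (by fun_prop) (by fun_prop) (by fun_prop) hY hZ
    have hXYZ := IndepFun.prodMk_prod (by fun_prop) (by fun_prop) (by fun_prop) (by fun_prop)
      hX hYZ
    let φ : ℝ × ℝ × ℝ → ℝ × ℝ := fun q ↦ (q.1 - q.2.1, s * (q.2.2 - (q.1 + q.2.1) / 2))
    have hφ : Measurable φ := by fun_prop
    exact hXYZ.comp hφ hφ
  have memLp_contrast (t : ℕ) : MemLp (meanContrast n m t) 2 (μ1.prod (μ2.prod μ3)) := by
    have hXY := (lawX t).hasGaussianLaw.memLp_two.add (lawY t).hasGaussianLaw.memLp_two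
    refine ((lawZ t).hasGaussianLaw.memLp_two.sub (hXY.const_mul 2⁻¹)).ae_eq (.of_forall fun ω ↦ ?_)
    simp only [meanContrast, Pi.sub_apply, Pi.add_apply]
    ring
  have hτ : (((n : NNReal)⁻¹ + (n : NNReal)⁻¹ : NNReal) : ℝ) = 2 * (n : ℝ)⁻¹ := by
    push_cast; ring
  have key := measureReal_thresholded_sum_nonpos_le (P := μ1.prod (μ2.prod μ3)) hHM
    (U := meanDifference n m) (W := fun t ω ↦ s * meanContrast n m t ω)
    (Δ := fun t ↦ θ1 t - θ2 t) (σ2 := (m : ℝ)⁻¹ + (n : ℝ)⁻¹ / 2)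
    (τ2 := (n : NNReal)⁻¹ + (n : NNReal)⁻¹) hr measurable_meanDifference
    (fun t ↦ hasLaw_sub_of_indepFun (lawX t) (lawY t)
      ((indXYZ t).comp (φ := id) (ψ := Prod.fst) measurable_id measurable_fst))
    (fun t ↦ (memLp_contrast t).const_mul s)
    (fun t ↦ by
      rw [integral_const_mul, ← hθ t]
      congr 1
      exact integral_contrast (lawX t) (lawY t) (lawZ t))
    (fun t ↦ by
      rw [variance_const_mul, hs, one_mul]
      have := variance_contrast (lawX t) (lawY t) (lawZ t) (indXYZ t) (indYZ t)
      push_cast at this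
      exact this)
    (fun t ↦ (indepFun_difference_contrast (lawX t) (lawY t) (lawZ t) (indXYZ t) (indYZ t)).comp
      measurable_id (measurable_const_mul s))
    hpair (by positivity) hpos (by rw [hτ]; exact hnum)
  rw [hτ] at key
  convert key using 4 with ω
  simp only [thresholdStatistic, mul_add, Finset.mul_sum]
  congr! 3 <;> ring

end Test

/-- Parameters in an `ℓ_p` body have differences in twice that body. -/
lemma sum_half_abs_sub_rpow_le_one {p : ℝ} (hp : 1 ≤ p) {a u v : ℕ → ℝ} (ha0 : ∀ t, 0 < a t)
    (hu : ∑' t, ENNReal.ofReal (|u t| ^ p / a t ^ p) ≤ 1)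
    (hv : ∑' t, ENNReal.ofReal (|v t| ^ p / a t ^ p) ≤ 1) (s : Finset ℕ) :
    ∑ t ∈ s, (|u t - v t| / (2 * a t)) ^ p ≤ 1 := by
  have hnn (w : ℕ → ℝ) (t : ℕ) : 0 ≤ |w t| ^ p / a t ^ p := by have := ha0 t; positivity
  have hu' := sum_le_one_of_tsum_ofReal_le_one (hnn u) hu s
  have hv' := sum_le_one_of_tsum_ofReal_le_one (hnn v) hv s
  refine (Finset.sum_le_sum fun t _ ↦ half_abs_sub_rpow_le hp (ha0 t)).trans ?_
  rw [Finset.sum_add_distrib, ← Finset.mul_sum, ← Finset.mul_sum]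
  linarith

lemma apply_sSup_lt_of_tendsto_zero {q : ℕ → ℝ} {c : ℝ} (hc : 0 < c) (hq : Filter.Tendsto q Filter.atTop (nhds 0)) :
    q (sSup {d : ℕ | 1 ≤ d ∧ c ≤ q (d - 1)}) < c := by
  by_contra! h
  have hbdd : BddAbove {d : ℕ | 1 ≤ d ∧ c ≤ q (d - 1)} := by
    obtain ⟨N, hN⟩ := Filter.eventually_atTop.1 (hq.eventually_lt_const hc)
    refine ⟨N, fun d hd ↦ ?_⟩
    by_contra! hdN
    exact absurd (hN (d - 1) (by omega)) (not_lt.2 hd.2)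
  have := le_csSup hbdd (show _ + 1 ∈ {d : ℕ | 1 ≤ d ∧ c ≤ q (d - 1)} from ⟨by omega, by simpa using h⟩)
  omega

/-- Achievability for LFHT over infinite-dimensional `ℓ_p` bodies with `1 ≤ p ≤ 2`.
Coordinates are 0-indexed, so `a (d-1)` is the `d`-th weight (1-based); `Dc ε` is the
coordinate-wise Kolmogorov dimension `min{D ≥ 1 : a_D ≤ ε}` and `du` is the effective
dimension `d_u(Γ, n, ε)` (with `δ = 1/32`). -/
theorem lfht_lp_body_upper_seq (G : (ℕ → ℝ) → Measure (ℕ → ℝ))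
    (hG : ∀ θ : ℕ → ℝ, IsGaussianSeq θ (G θ))
    (p : ℝ) (hp1 : 1 ≤ p) (hp2 : p ≤ 2)
    (a : ℕ → ℝ) (ha : Antitone a) (ha0 : ∀ t, 0 < a t)
    (hlim : Filter.Tendsto a Filter.atTop (nhds 0))
    (Γ : Set SeqL2)
    (hΓ : Γ = {θ : SeqL2 | (∑' t : ℕ, ENNReal.ofReal (|θ t| ^ p / (a t) ^ p)) ≤ 1})
    (ε : ℝ) (hε : 0 < ε) (m n : ℕ) (hm0 : 0 < m) (hn0 : 0 < n)
    (Dc : ℝ → ℕ) (hDc : ∀ ε' : ℝ, Dc ε' = sInf {d : ℕ | 1 ≤ d ∧ a (d - 1) ≤ ε'})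
    (du : ℕ)
    (hdu : du = sSup {d : ℕ | 1 ≤ d ∧
      (ε ^ 2 / 9) / (576 * Real.log (4 * (Dc (ε / 3) : ℝ) / (1/32)))
        ≤ (a (d - 1)) ^ p * (n : ℝ) ^ ((p - 2) / 2)})
    (hm : 32 / ε ^ 2 ≤ (m : ℝ))
    (hn : 32 * Real.sqrt du / ε ^ 2 ≤ (n : ℝ))
    (hmn : 512 * (du : ℝ) / ε ^ 4 ≤ (m : ℝ) * (n : ℝ)) :
    LFHTFeasibleSeq G Γ ε m n := by
  obtain ⟨D, hD⟩ : ∃ D, D = Dc (ε / 3) := ⟨_, rfl⟩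
  rw [← hD] at hdu
  have hne : {d : ℕ | 1 ≤ d ∧ a (d - 1) ≤ ε / 3}.Nonempty := by
    obtain ⟨N, hN⟩ := Filter.eventually_atTop.1
      (hlim.eventually_lt_const (show 0 < ε / 3 by positivity))
    exact ⟨N + 1, by omega, (hN _ (by simp)).le⟩
  have hDmem := Nat.sInf_mem hne
  rw [← hDc, ← hD] at hDmem
  obtain ⟨hD1, haD⟩ := hDmem
  have hDmin (d : ℕ) (hd : d < D - 1) : ε / 3 < a d := by
    by_contra! hle
    have := Nat.sInf_le (show d + 1 ∈ {d : ℕ | 1 ≤ d ∧ a (d - 1) ≤ ε / 3} from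
      ⟨by omega, by simpa using hle⟩)
    rw [← hDc, ← hD] at this
    omega
  have hDR : (1 : ℝ) ≤ D := by exact_mod_cast hD1
  set L := Real.log (4 * (D : ℝ) / (1 / 32)) with hL
  have hexpL : Real.exp L = 128 * D := by rw [hL, Real.exp_log (by positivity)]; ring
  have hL485 : 4.85 ≤ L := by
    have h128 : Real.log 128 = 7 * Real.log 2 := by
      rw [show (128 : ℝ) = 2 ^ 7 by norm_num, Real.log_pow]; norm_num
    have : Real.log 128 ≤ L := Real.log_le_log (by norm_num) (by linarith)
    linarith [Real.log_two_gt_d9]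
  have hL0 : 0 < L := by linarith
  have hnR : (0 : ℝ) < n := by exact_mod_cast hn0
  have hmR : (0 : ℝ) < m := by exact_mod_cast hm0
  have hsmall : a du ^ p * (n : ℝ) ^ ((p - 2) / 2) < ε ^ 2 / (5184 * L) := by
    have hq : Filter.Tendsto (fun d ↦ a d ^ p * (n : ℝ) ^ ((p - 2) / 2)) Filter.atTop (nhds 0) := by
      have := (hlim.rpow_const (p := p) (Or.inr (by linarith))).mul_const ((n : ℝ) ^ ((p - 2) / 2))
      rwa [Real.zero_rpow (by linarith), zero_mul] at this
    have := apply_sSup_lt_of_tendsto_zero (c := (ε ^ 2 / 9) / (576 * L)) (by positivity) hq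
    rw [← hdu] at this
    refine this.trans_eq ?_
    field_simp
    norm_num
  have hmε : 32 ≤ (m : ℝ) * ε ^ 2 := by rwa [div_le_iff₀ (by positivity)] at hm
  have hnε : 32 * √du ≤ (n : ℝ) * ε ^ 2 := by rwa [div_le_iff₀ (by positivity)] at hn
  have hmnε : 512 * (du : ℝ) ≤ m * n * ε ^ 4 := by rwa [div_le_iff₀ (by positivity)] at hmn
  set r := √(8 * L / n) with hr
  have hr0 : 0 < r := Real.sqrt_pos.2 (by positivity)
  set M := Finset.Ico du (D - 1) with hM
  have hexp : 33 / 133 + M.card * (2 * Real.exp (-r ^ 2 / (2 * (2 * (n : ℝ)⁻¹)))) ≤ 1 / 4 := by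
    have hexponent : -r ^ 2 / (2 * (2 * (n : ℝ)⁻¹)) = -(L + L) := by
      rw [hr, Real.sq_sqrt (by positivity)]
      field_simp
      norm_num
    have hcard : (M.card : ℝ) ≤ D := by
      rw [hM, Nat.card_Ico]
      exact_mod_cast (by omega : D - 1 - du ≤ D)
    rw [hexponent, Real.exp_neg, Real.exp_add, hexpL]
    have : (M.card : ℝ) * (2 * (128 * D * (128 * D) : ℝ)⁻¹) ≤ 1 / 8192 := by
      calc (M.card : ℝ) * (2 * (128 * D * (128 * D) : ℝ)⁻¹)
          ≤ D * (2 * (128 * D * (128 * D) : ℝ)⁻¹) := by gcongr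
        _ = 1 / 8192 * (D : ℝ)⁻¹ := by field_simp; norm_num
        _ ≤ 1 / 8192 * 1 := by gcongr; exact inv_le_one_of_one_le₀ hDR
        _ = 1 / 8192 := mul_one _
    linarith
  have hHM : Disjoint (Finset.range du) M := by
    rw [hM, Finset.range_eq_Ico]
    exact Finset.Ico_disjoint_Ico_consecutive 0 du (D - 1)
  have herror : ∀ θ1 ∈ Γ, ∀ θ2 ∈ Γ, ε ≤ ‖θ1 - θ2‖ → ∀ (θ : SeqL2) (s : ℝ), s ^ 2 = 1 →
      (∀ t, s * (θ t - (θ1 t + θ2 t) / 2) = (θ1 t - θ2 t) / 2) →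
      ((iidSamples n (G ⇑θ1)).prod ((iidSamples n (G ⇑θ2)).prod (iidSamples m (G ⇑θ))))
        {ω | s * thresholdStatistic n m (Finset.range du) M (29 * r) ω ≤ 0} ≤ 1 / 4 := by
    intro θ1 hθ1 θ2 hθ2 hsep θ s hs hθ
    have := (hG θ1).1
    have := (hG θ2).1
    have := (hG θ).1
    rw [hΓ] at hθ1 hθ2
    have hx := sum_half_abs_sub_rpow_le_one hp1 ha0 hθ1 hθ2
    have hnorm (K : ℕ) : ε ^ 2 ≤ ∑ t ∈ Finset.range K, (θ1 t - θ2 t) ^ 2 + 4 * a K ^ 2 :=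
      (pow_le_pow_left₀ hε.le hsep 2).trans
        (norm_sq_le_sum_range_add hp1 hp2 ha ha0 (θ := θ1 - θ2) hx K)
    obtain ⟨hpos, hnum⟩ := signal_dominates_noise hp1 hp2 ha ha0 hx hε hmR hnR hL485 hnorm hsmall
      haD (hDmin du) hmε hnε hmnε
    have hreal := (measureReal_sign_mul_thresholdStatistic_nonpos_le (hG θ1) (hG θ2) (hG θ) hn0 hm0
      hs hθ hHM hr0 hpos (by rw [Finset.card_range]; exact hnum)).trans hexp
    rw [← ofReal_measureReal]
    refine (ENNReal.ofReal_le_ofReal hreal).trans_eq ?_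
    rw [ENNReal.ofReal_div_of_pos (by norm_num)]
    simp
  refine ⟨fun ω ↦ decide (thresholdStatistic n m (Finset.range du) M (29 * r) ω < 0), ?_, ?_⟩
  · exact measurable_to_bool (by
      simpa [Set.preimage] using
        measurableSet_lt (measurable_thresholdStatistic (Finset.range du) M (29 * r))
          measurable_const)
  · intro θ1 hθ1 θ2 hθ2 hsep
    refine ⟨(measure_mono fun ω hω ↦ ?_).trans
        (herror θ1 hθ1 θ2 hθ2 hsep θ1 1 (by norm_num) fun t ↦ by ring),
      (measure_mono fun ω hω ↦ ?_).trans
        (herror θ1 hθ1 θ2 hθ2 hsep θ2 (-1) (by norm_num) fun t ↦ by ring)⟩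
    · have : thresholdStatistic n m (Finset.range du) M (29 * r) ω < 0 := by simpa using hω
      simpa using this.le
    · simpa using hω
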